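/- arXiv:math/0403149 — 8 statements merged into one kernel-verified Lean document; each statement's English description precedes it below -/
import Mathlib

section
/- Let A be a unital complex *-algebra that is algebraically bounded, and let C ⊆ A_h be a wedge with Σ²(A) ⊆ C. If z ∈ A_h and z ∉ C, then there exists a ℂ-linear functional F : A → ℂ such that F(1) = 1, F(x*) = conj(F(x)) for all x ∈ A, F(x) is a nonnegative real number for every x ∈ C, and F(z) is a nonpositive real number. -/
/-- A pointed cone for which `e` is an order unit, and which does not contain `-e`, admits a
nonnegative linear functional normalized at `e`. -/
theorem PointedCone.exists_nonneg_dual_eq_one {E : Type*} [AddCommGroup E] [Module ℝ E]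
    (s : PointedCone ℝ E) (e : E) (he : -e ∉ s) (hunit : ∀ y, ∃ r : ℝ, r • e + y ∈ s) :
    ∃ g : E →ₗ[ℝ] ℝ, g e = 1 ∧ ∀ x ∈ s, 0 ≤ g x := by
  have he0 : e ≠ 0 := by
    rintro rfl
    exact he (by simp)
  let f : E →ₗ.[ℝ] ℝ := LinearPMap.mkSpanSingleton e 1 he0
  obtain ⟨g, hgf, hgs⟩ := riesz_extension s f (by
      rintro ⟨x, hx⟩ hxs
      obtain ⟨r, rfl⟩ := Submodule.mem_span_singleton.1 hx
      have hfr : f ⟨r • e, hx⟩ = r :=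
        (LinearPMap.mkSpanSingleton'_apply (σ := RingHom.id ℝ) e (1 : ℝ) _ r hx).trans (mul_one r)
      rw [hfr]
      by_contra! hr
      refine he ?_
      have := s.smul_mem (inv_pos.2 (neg_pos.2 hr)).le hxs
      rwa [smul_smul, inv_neg, neg_mul, inv_mul_cancel₀ hr.ne, neg_one_smul]
        at this)
    (fun y ↦ by
      obtain ⟨r, hr⟩ := hunit y
      exact ⟨⟨r • e, Submodule.mem_span_singleton.2 ⟨r, rfl⟩⟩, hr⟩)
  exact ⟨g, (hgf ⟨e, Submodule.mem_span_singleton_self e⟩).trans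
    (LinearPMap.mkSpanSingleton_apply ℝ ℝ he0 1), hgs⟩

/-- Weak separation of a point from a pointed cone with order unit. -/
theorem PointedCone.exists_nonneg_dual_nonpos_of_notMem {E : Type*} [AddCommGroup E] [Module ℝ E]
    (C : PointedCone ℝ E) {e z : E} (he : e ∈ C) (hunit : ∀ y, ∃ r : ℝ, r • e + y ∈ C)
    (hz : z ∉ C) :
    ∃ g : E →ₗ[ℝ] ℝ, g e = 1 ∧ (∀ x ∈ C, 0 ≤ g x) ∧ g z ≤ 0 := by
  have hneg : -e ∉ C := by
    intro h
    obtain ⟨r, hr⟩ := hunit z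
    have hre : -(r • e) ∈ C := by
      rcases le_total 0 r with h0 | h0
      · simpa using C.smul_mem h0 h
      · simpa using C.smul_mem (neg_nonneg.2 h0) he
    exact hz (by simpa using C.add_mem hr hre)
  let s : PointedCone ℝ E := C ⊔ Submodule.span {c : ℝ // 0 ≤ c} {-z}
  have hs : -e ∉ s := by
    intro h
    obtain ⟨c, hc, w, hw, hcw⟩ := Submodule.mem_sup.1 h
    obtain ⟨⟨t, ht⟩, rfl⟩ := Submodule.mem_span_singleton.1 hw
    rw [Nonneg.mk_smul] at hcw
    rcases ht.eq_or_lt with rfl | ht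
    · exact hneg (by simpa [← hcw] using hc)
    · have htz : t • z = e + c := by
        rw [smul_neg, ← sub_eq_add_neg, sub_eq_iff_eq_add] at hcw
        rw [hcw, add_neg_cancel_left]
      refine hz ?_
      have := C.smul_mem (inv_pos.2 ht).le (C.add_mem he hc)
      rwa [← htz, inv_smul_smul₀ ht.ne'] at this
  have hCs : C ≤ s := le_sup_left
  obtain ⟨g, hge, hgs⟩ := s.exists_nonneg_dual_eq_one e hs fun y ↦
    (hunit y).imp fun _ h ↦ hCs h
  refine ⟨g, hge, fun x hx ↦ hgs x (hCs hx), ?_⟩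
  have := hgs (-z) ((le_sup_right : _ ≤ s) (Submodule.mem_span_singleton_self (-z)))
  rwa [map_neg, neg_nonneg] at this


/-- Σ²(A): the set of all finite sums of elements of the form `star y * y`. -/
def sumOfSquares (A : Type*) [Ring A] [StarRing A] : AddSubmonoid A :=
  AddSubmonoid.closure {x : A | ∃ y : A, x = star y * y}

/-- Let `A` be a unital complex *-algebra that is algebraically bounded,
and let `C ⊆ A_h` be a wedge with `Σ²(A) ⊆ C`.  If `z` is hermitian and `z ∉ C`, then
there exists a ℂ-linear functional `F : A → ℂ` with `F 1 = 1`, `F (x*) = conj (F x)`,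
`F x` a nonnegative real for every `x ∈ C`, and `F z` a nonpositive real. -/
theorem statement0 {A : Type*} [Ring A] [Algebra ℂ A] [StarRing A] [StarModule ℂ A]
    (hbd : ∀ a : A, star a = a →
      ∃ lam : ℝ, 0 < lam ∧ (lam : ℂ) • (1 : A) - a ∈ sumOfSquares A)
    (C : Set A)
    (hCherm : ∀ x ∈ C, star x = x)
    (hCadd : ∀ x ∈ C, ∀ y ∈ C, x + y ∈ C)
    (hCsmul : ∀ x ∈ C, ∀ r : ℝ, 0 ≤ r → (r : ℂ) • x ∈ C)
    (hSqC : ∀ x : A, x ∈ sumOfSquares A → x ∈ C)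
    (z : A) (hz : star z = z) (hzC : z ∉ C) :
    ∃ F : A →ₗ[ℂ] ℂ,
      F 1 = 1 ∧
      (∀ x : A, F (star x) = starRingEnd ℂ (F x)) ∧
      (∀ x ∈ C, ∃ r : ℝ, 0 ≤ r ∧ F x = r) ∧
      (∃ r : ℝ, r ≤ 0 ∧ F z = r) := by
  have hsmul {x : A} (hx : x ∈ C) {r : ℝ} (hr : 0 ≤ r) : r • x ∈ C := by
    simpa only [Complex.coe_smul] using hCsmul x hx r hr
  have hone : (1 : A) ∈ C := hSqC 1 (AddSubmonoid.subset_closure ⟨1, by simp⟩)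
  have hzero : (0 : A) ∈ C := hSqC 0 (zero_mem _)
  have hhalf {x : A} (h : x + x ∈ C) : x ∈ C := by
    have := hsmul h (r := 1 / 2) (by norm_num)
    rwa [← two_smul ℝ x, smul_smul, one_div, inv_mul_cancel₀ two_ne_zero, one_smul] at this
  have star_smul_real (r : ℝ) (x : A) : star (r • x) = r • star x := by
    rw [← Complex.coe_smul, star_smul, ← Complex.coe_smul]
    simp
  let P : PointedCone ℝ A :=
    { carrier := {x | x + star x ∈ C}
      zero_mem' := by simpa using hzero
      add_mem' := fun {x y} hx hy ↦ by
        have := hCadd _ hx _ hy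
        rwa [add_add_add_comm, ← star_add] at this
      smul_mem' := fun ⟨r, hr⟩ x hx ↦ by
        have := hsmul hx hr
        rwa [smul_add, ← star_smul_real] at this }
  have mem_P {x : A} : x ∈ P ↔ x + star x ∈ C := Iff.rfl
  have hCP {x : A} (hx : x ∈ C) : x ∈ P := by
    rw [mem_P, hCherm x hx]
    exact hCadd x hx x hx
  obtain ⟨g, hg1, hgP, hgz⟩ := P.exists_nonneg_dual_nonpos_of_notMem (e := 1) (z := z) (hCP hone)
    (fun y ↦ by
      obtain ⟨r, -, hr⟩ := hbd (-(y + star y)) (by simp [add_comm])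
      refine ⟨r / 2, ?_⟩
      rw [mem_P, star_add, star_smul_real, star_one, add_add_add_comm, ← add_smul, add_halves]
      simpa only [sub_neg_eq_add, Complex.coe_smul] using hSqC _ hr)
    (fun h ↦ hzC (hhalf (by rwa [mem_P, hz] at h)))
  have hg_skew {x : A} (hx : star x = -x) : g x = 0 := by
    refine le_antisymm ?_ (hgP x (by simpa [mem_P, hx] using hzero))
    have := hgP (-x) (by simpa [mem_P, hx] using hzero)
    rwa [map_neg, neg_nonneg] at this
  have hg_star (x : A) : g (star x) = g x := by
    rw [← sub_eq_zero, ← map_sub]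
    exact hg_skew (by simp)
  have hg_I_star (x : A) : g (Complex.I • star x) = -g (Complex.I • x) := by
    rw [← hg_star (Complex.I • x), ← map_neg]
    simp [star_smul]
  let F : A →ₗ[ℂ] ℂ := Module.Dual.extendRCLike (𝕜 := ℂ) g
  have hF (x : A) : F x = g x - Complex.I * g (Complex.I • x) :=
    Module.Dual.extendRCLike_apply g x
  have hF_herm {x : A} (hx : star x = x) : F x = g x := by
    have hIx : g (Complex.I • x) = 0 := hg_skew (by simp [star_smul, hx])
    simp [hF, hIx]
  refine ⟨F, by simp [hF_herm (star_one A), hg1], fun x ↦ ?_,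
    fun x hx ↦ ⟨g x, hgP x (hCP hx), hF_herm (hCherm x hx)⟩, g z, hgz, hF_herm hz⟩
  rw [hF, hF, hg_star, hg_I_star]
  simp
end

section
/- Let X be the (unital) subring of B generated by the set {y·r : r ∈ R} ∪ {r·y : r ∈ R}. Then for every n ∈ ℕ and every finite family z₁, …, z_q ∈ X there exists s ∈ S such that z_j · aⁿ · s ∈ R for every j = 1, …, q. -/
/-- The elements `b` of `B` such that every `b * r` with `r ∈ R` is moved into `R` by right
multiplication by an element of the submonoid `S` of `R`. -/
def Subring.rightDenominators {B : Type*} [Ring B] (R : Subring B) (S : Submonoid B)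
    (hSR : (S : Set B) ⊆ (R : Set B)) : Subring B where
  carrier := {b | ∀ r ∈ R, ∃ s ∈ S, b * r * s ∈ R}
  one_mem' := fun r hr => ⟨1, S.one_mem, by simpa using hr⟩
  zero_mem' := fun r _ => ⟨1, S.one_mem, by simp⟩
  neg_mem' := by
    intro b hb r hr
    obtain ⟨s, hs, h⟩ := hb r hr
    exact ⟨s, hs, by simpa using h⟩
  mul_mem' := by
    intro b c hb hc r hr
    obtain ⟨s, hs, h⟩ := hc r hr
    obtain ⟨t, ht, h'⟩ := hb _ h
    exact ⟨s * t, S.mul_mem hs ht, by simpa only [mul_assoc] using h'⟩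
  add_mem' := by
    intro b c hb hc r hr
    obtain ⟨s, hs, h⟩ := hb r hr
    obtain ⟨t, ht, h'⟩ := hc (r * s) (R.mul_mem hr (hSR hs))
    refine ⟨s * t, S.mul_mem hs ht, ?_⟩
    have := R.add_mem (R.mul_mem h (hSR ht)) h'
    simpa only [add_mul, mul_assoc] using this

/-- Finitely many elements of `R.rightDenominators S` admit a common denominator. -/
theorem Subring.exists_common_rightDenominator {B : Type*} [Ring B] (R : Subring B)
    (S : Submonoid B) (hSR : (S : Set B) ⊆ (R : Set B)) {ι : Type*} (t : Finset ι) (z : ι → B)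
    (hz : ∀ j ∈ t, z j ∈ R.rightDenominators S hSR) {r : B} (hr : r ∈ R) :
    ∃ s ∈ S, ∀ j ∈ t, z j * r * s ∈ R := by
  classical
  induction t using Finset.induction_on with
  | empty => exact ⟨1, S.one_mem, by simp⟩
  | insert i t _ ih =>
    obtain ⟨s, hs, h⟩ := ih fun j hj => hz j (Finset.mem_insert_of_mem hj)
    obtain ⟨u, hu, h'⟩ :=
      hz i (Finset.mem_insert_self i t) (r * s) (R.mul_mem hr (hSR hs))
    refine ⟨s * u, S.mul_mem hs hu, fun j hj => ?_⟩
    rcases Finset.mem_insert.1 hj with rfl | hj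
    · simpa only [mul_assoc] using h'
    · simpa only [mul_assoc] using R.mul_mem (h j hj) (hSR hu)


/-- Let `B` be a unital ring, `R` a subring of `B`, and `S` a
multiplicative submonoid contained in `R` that is right Ore in `R`.  Assume `a ∈ S`
is invertible in `B` with inverse `y`.  Let `X` be the unital subring of `B` generated
by `{y·r : r ∈ R} ∪ {r·y : r ∈ R}`.  Then for every `n : ℕ` and every finite family
`z₁, …, z_q ∈ X` there exists `s ∈ S` with `z_j · aⁿ · s ∈ R` for every `j`. -/
theorem statement1 {B : Type*} [Ring B] (R : Subring B) (S : Submonoid B)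
    (hSR : (S : Set B) ⊆ (R : Set B))
    (hOre : ∀ s ∈ S, ∀ r ∈ R, ∃ r' ∈ R, ∃ s' ∈ S, s * r' = r * s')
    (a : B) (haS : a ∈ S) (y : B) (hay : a * y = 1) (hya : y * a = 1)
    (n : ℕ) (q : ℕ) (z : Fin q → B)
    (hz : ∀ j, z j ∈ Subring.closure {b : B | (∃ r ∈ R, b = y * r) ∨ (∃ r ∈ R, b = r * y)}) :
    ∃ s ∈ S, ∀ j, z j * a ^ n * s ∈ R := by
  have hy : ∀ r ∈ R, ∃ s ∈ S, y * r * s ∈ R := by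
    intro r hr
    obtain ⟨r', hr', s, hs, h⟩ := hOre a haS r hr
    refine ⟨s, hs, ?_⟩
    rwa [mul_assoc, ← h, ← mul_assoc, hya, one_mul]
  have hX : Subring.closure {b : B | (∃ r ∈ R, b = y * r) ∨ (∃ r ∈ R, b = r * y)} ≤
      R.rightDenominators S hSR := by
    have hR : R ≤ R.rightDenominators S hSR :=
      fun b hb r hr => ⟨1, S.one_mem, by simpa using R.mul_mem hb hr⟩
    have hyD : y ∈ R.rightDenominators S hSR := hy
    rw [Subring.closure_le]
    rintro b (⟨r, hr, rfl⟩ | ⟨r, hr, rfl⟩)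
    · exact mul_mem hyD (hR hr)
    · exact mul_mem (hR hr) hyD
  obtain ⟨s, hs, h⟩ := R.exists_common_rightDenominator S hSR Finset.univ z
    (fun j _ => hX (hz j)) (R.pow_mem (hSR haS) n)
  exact ⟨s, hs, fun j => h j (Finset.mem_univ j)⟩
end

section
/- In the setting described, the following identities hold in B: (r1) Σ_{k=0}^d Y_{k0}* Y_{k0} = Y; (r2) Y_{k0}* Y_{l0} − Y_{l0}* Y_{k0} = −i Σ_{j=1}^d c^j_{lk} · Y · Y_{j0} for all k, l ∈ {1,…,d}; (r3) Y_{k0}* − Y_{k0} = i Σ_{j,l=1}^d b^j_{kl} · Y_{j0}* Y_{l0} for all k ∈ {1,…,d}. -/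
open scoped BigOperators

/-- The extended family `X₀, X₁, …, X_d` where `X₀ = i·1`. -/
noncomputable def extX {B : Type*} [Ring B] [Algebra ℂ B] {d : ℕ} (X : Fin d → B) :
    Fin (d + 1) → B :=
  Fin.cases (Complex.I • (1 : B)) X

/-- The elements `Y_{kl} := X_k X_l Y` for `k, l = 0, …, d`. -/
noncomputable def Ymat {B : Type*} [Ring B] [Algebra ℂ B] {d : ℕ} (X : Fin d → B) (Y : B)
    (k l : Fin (d + 1)) : B :=
  extX X k * extX X l * Y

open Complex in
theorem Ymat_succ_zero {B : Type*} [Ring B] [Algebra ℂ B] {d : ℕ} (X : Fin d → B) (Y : B)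
    (k : Fin d) : Ymat X Y k.succ 0 = I • (X k * Y) := by
  simp [Ymat, extX]

theorem Ymat_zero_zero {B : Type*} [Ring B] [Algebra ℂ B] {d : ℕ} (X : Fin d → B) (Y : B) :
    Ymat X Y 0 0 = -Y := by
  simp [Ymat, extX, smul_smul]

open Complex in
theorem star_Ymat_succ_zero {B : Type*} [Ring B] [Algebra ℂ B] [StarRing B] [StarModule ℂ B]
    {d : ℕ} {X : Fin d → B} {Y : B} (hX : ∀ k, star (X k) = -X k) (hY : star Y = Y)
    (k : Fin d) : star (Ymat X Y k.succ 0) = I • (Y * X k) := by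
  simp [Ymat_succ_zero, star_smul, hX, hY]

open Complex in
theorem star_Ymat_mul_Ymat {B : Type*} [Ring B] [Algebra ℂ B] [StarRing B] [StarModule ℂ B]
    {d : ℕ} {X : Fin d → B} {Y : B} (hX : ∀ k, star (X k) = -X k) (hY : star Y = Y)
    (k l : Fin d) :
    star (Ymat X Y k.succ 0) * Ymat X Y l.succ 0 = -(Y * (X k * X l) * Y) := by
  rw [star_Ymat_succ_zero hX hY, Ymat_succ_zero, smul_mul_smul_comm, I_mul_I, neg_one_smul]
  noncomm_ring

theorem star_eq_of_mul_eq_one {B : Type*} [Ring B] [StarRing B] {A Y : B} (hA : star A = A)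
    (hAY : A * Y = 1) : star Y = Y := by
  have h : star Y * A = 1 := by rw [← hA, ← star_mul, hAY, star_one]
  exact left_inv_eq_right_inv h hAY

/-- In the setting of the paper, the relations (r1)–(r3) hold:
`Σ_{k=0}^d Y_{k0}* Y_{k0} = Y`;
`Y_{k0}* Y_{l0} − Y_{l0}* Y_{k0} = −i Σ_j c^j_{lk} Y Y_{j0}` for `k,l = 1,…,d`;
`Y_{k0}* − Y_{k0} = i Σ_{j,l} b^j_{kl} Y_{j0}* Y_{l0}` for `k = 1,…,d`,
where `b^j_{kl} = c^j_{kl} + c^l_{kj}`. -/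
theorem statement3 {B : Type*} [Ring B] [Algebra ℂ B] [StarRing B] [StarModule ℂ B]
    (d : ℕ) (hd : 1 ≤ d)
    (c : Fin d → Fin d → Fin d → ℝ)
    (hc : ∀ k i j, c k i j = - c k j i)
    (X : Fin d → B)
    (hXstar : ∀ k, star (X k) = - X k)
    (hXlie : ∀ i j, X i * X j - X j * X i = ∑ k : Fin d, (c k i j : ℂ) • X k)
    (A Y : B) (hA : A = 1 - ∑ k : Fin d, X k ^ 2)
    (hAY : A * Y = 1) (hYA : Y * A = 1) :
    (∑ k : Fin (d + 1), star (Ymat X Y k 0) * Ymat X Y k 0 = Y) ∧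
    (∀ k l : Fin d,
      star (Ymat X Y k.succ 0) * Ymat X Y l.succ 0
          - star (Ymat X Y l.succ 0) * Ymat X Y k.succ 0
        = -(Complex.I) • ∑ j : Fin d, (c j l k : ℂ) • (Y * Ymat X Y j.succ 0)) ∧
    (∀ k : Fin d,
      star (Ymat X Y k.succ 0) - Ymat X Y k.succ 0
        = Complex.I • ∑ j : Fin d, ∑ l : Fin d,
            ((c j k l + c l k j : ℝ) : ℂ) • (star (Ymat X Y j.succ 0) * Ymat X Y l.succ 0)) := by
  have hAstar : star A = A := by simp [hA, star_sum, hXstar]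
  have hY := star_eq_of_mul_eq_one hAstar hAY
  refine ⟨?_, fun k l => ?_, fun k => ?_⟩
  · rw [Fin.sum_univ_succ, Ymat_zero_zero]
    simp only [star_Ymat_mul_Ymat hXstar hY, star_neg, hY, neg_mul_neg]
    rw [Finset.sum_neg_distrib, ← Finset.sum_mul, ← Finset.mul_sum]
    calc Y * Y + -(Y * (∑ k, X k * X k) * Y) = Y * (1 - ∑ k, X k ^ 2) * Y := by
          simp only [pow_two]; noncomm_ring
      _ = Y := by rw [← hA, hYA, one_mul]
  · rw [star_Ymat_mul_Ymat hXstar hY, star_Ymat_mul_Ymat hXstar hY]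
    calc -(Y * (X k * X l) * Y) - -(Y * (X l * X k) * Y)
        = Y * (X l * X k - X k * X l) * Y := by noncomm_ring
      _ = _ := by
        rw [hXlie, Finset.mul_sum, Finset.sum_mul, Finset.smul_sum]
        refine Finset.sum_congr rfl fun j _ => ?_
        rw [Ymat_succ_zero, mul_smul_comm Complex.I, smul_comm (c j l k : ℂ), smul_smul,
          neg_mul, Complex.I_mul_I, neg_neg, one_smul, mul_smul_comm, smul_mul_assoc, mul_assoc]
  · have hcomm : X k * A - A * X k
        = -∑ j, ∑ l, ((c j k l + c l k j : ℝ) : ℂ) • (X j * X l) := by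
      calc X k * A - A * X k = -∑ j, (X k * X j ^ 2 - X j ^ 2 * X k) := by
            rw [hA, Finset.sum_sub_distrib, ← Finset.mul_sum, ← Finset.sum_mul]
            noncomm_ring
        _ = -∑ j, ((X k * X j - X j * X k) * X j + X j * (X k * X j - X j * X k)) := by
            congr 1
            exact Finset.sum_congr rfl fun j _ => by noncomm_ring
        _ = _ := by
            simp only [hXlie, Finset.sum_mul, Finset.mul_sum, smul_mul_assoc, mul_smul_comm,
              Complex.ofReal_add, add_smul, Finset.sum_add_distrib]
            rw [Finset.sum_comm]
    rw [star_Ymat_succ_zero hXstar hY, Ymat_succ_zero, ← smul_sub]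
    congr 1
    calc Y * X k - X k * Y = Y * X k * (A * Y) - (Y * A) * X k * Y := by
          rw [hAY, hYA, mul_one, one_mul]
      _ = Y * (X k * A - A * X k) * Y := by noncomm_ring
      _ = _ := by
        simp only [hcomm, star_Ymat_mul_Ymat hXstar hY, mul_neg, neg_mul, smul_neg,
          Finset.sum_neg_distrib, Finset.mul_sum, Finset.sum_mul, mul_smul_comm, smul_mul_assoc]
end

section
/- In the setting described, for all k, l ∈ {0,…,d} the elements Y_{kl} − Y_{kl}* and Y_{kl} − Y_{lk} belong to the ideal 𝒳₀. -/
open scoped BigOperators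

/-- The *-algebra `𝒳`: the unital subalgebra of `B` generated by all elements
`X_k X_l Y` and `Y X_l X_k` with `k, l = 0, …, d`. -/
noncomputable def scriptX {B : Type*} [Ring B] [Algebra ℂ B] {d : ℕ} (X : Fin d → B) (Y : B) :
    Subalgebra ℂ B :=
  Algebra.adjoin ℂ
    {b : B | ∃ k l : Fin (d + 1), b = extX X k * extX X l * Y ∨ b = Y * (extX X l * extX X k)}

/-- The two-sided ideal `𝒳₀` of `𝒳` generated by the elements `X_k Y` and `Y X_k`,
`k = 0, …, d`: its elements are the finite sums of products `x · g · z` with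
`x, z ∈ 𝒳` and `g` one of the generators. -/
noncomputable def scriptX0 {B : Type*} [Ring B] [Algebra ℂ B] {d : ℕ} (X : Fin d → B) (Y : B) :
    AddSubgroup B :=
  AddSubgroup.closure
    {b : B | ∃ x ∈ scriptX X Y, ∃ z ∈ scriptX X Y, ∃ k : Fin (d + 1),
      b = x * (extX X k * Y) * z ∨ b = x * (Y * extX X k) * z}

section Helpers

variable {B : Type*} [Ring B] [Algebra ℂ B] {d : ℕ} {X : Fin d → B} {Y : B}

lemma mul_mem_scriptX0_left {a b : B} (ha : a ∈ scriptX X Y) (hb : b ∈ scriptX0 X Y) :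
    a * b ∈ scriptX0 X Y := by
  unfold scriptX0 at hb
  induction hb using AddSubgroup.closure_induction with
  | mem g hg =>
    obtain ⟨x, hx, z, hz, k, rfl | rfl⟩ := hg
    · exact AddSubgroup.subset_closure
        ⟨a * x, mul_mem ha hx, z, hz, k, Or.inl (by simp only [mul_assoc])⟩
    · exact AddSubgroup.subset_closure
        ⟨a * x, mul_mem ha hx, z, hz, k, Or.inr (by simp only [mul_assoc])⟩
  | zero => simp [zero_mem]
  | add g h _ _ hg hh => rw [mul_add]; exact add_mem hg hh
  | neg g _ hg => rw [mul_neg]; exact neg_mem hg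

lemma smul_mem_scriptX0 (r : ℂ) {b : B} (hb : b ∈ scriptX0 X Y) : r • b ∈ scriptX0 X Y := by
  rw [← one_mul b, ← smul_mul_assoc]
  exact mul_mem_scriptX0_left (Subalgebra.smul_mem _ (one_mem _) r) hb

lemma mul_right_mem_scriptX0_of_mem_span {u : B}
    (hu : u ∈ Submodule.span ℂ (Set.range (extX X))) : u * Y ∈ scriptX0 X Y := by
  induction hu using Submodule.span_induction with
  | mem g hg =>
    obtain ⟨k, rfl⟩ := hg
    exact AddSubgroup.subset_closure
      ⟨1, one_mem _, 1, one_mem _, k, Or.inl (by simp only [one_mul, mul_one])⟩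
  | zero => simp [zero_mem]
  | add g h _ _ hg hh => rw [add_mul]; exact add_mem hg hh
  | smul r g _ hg => rw [smul_mul_assoc]; exact smul_mem_scriptX0 r hg

lemma mul_left_mem_scriptX0_of_mem_span {u : B}
    (hu : u ∈ Submodule.span ℂ (Set.range (extX X))) : Y * u ∈ scriptX0 X Y := by
  induction hu using Submodule.span_induction with
  | mem g hg =>
    obtain ⟨k, rfl⟩ := hg
    exact AddSubgroup.subset_closure
      ⟨1, one_mem _, 1, one_mem _, k, Or.inr (by simp only [one_mul, mul_one])⟩
  | zero => simp [zero_mem]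
  | add g h _ _ hg hh => rw [mul_add]; exact add_mem hg hh
  | smul r g _ hg => rw [mul_smul_comm]; exact smul_mem_scriptX0 r hg

lemma mul_mul_mem_scriptX_of_mem_span {u v : B}
    (hu : u ∈ Submodule.span ℂ (Set.range (extX X)))
    (hv : v ∈ Submodule.span ℂ (Set.range (extX X))) : Y * (u * v) ∈ scriptX X Y := by
  induction hu, hv using Submodule.span_induction₂ with
  | mem_mem u v hu hv =>
    obtain ⟨k, rfl⟩ := hu
    obtain ⟨l, rfl⟩ := hv
    exact Algebra.subset_adjoin ⟨l, k, Or.inr rfl⟩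
  | zero_left v _ => simp [zero_mem]
  | zero_right u _ => simp [zero_mem]
  | add_left u v w _ _ _ h₁ h₂ => rw [add_mul, mul_add]; exact add_mem h₁ h₂
  | add_right u v w _ _ _ h₁ h₂ => rw [mul_add, mul_add]; exact add_mem h₁ h₂
  | smul_left r u v _ _ h =>
    rw [smul_mul_assoc, mul_smul_comm]; exact Subalgebra.smul_mem _ h r
  | smul_right r u v _ _ h =>
    rw [mul_smul_comm, mul_smul_comm]; exact Subalgebra.smul_mem _ h r

lemma mul_cubic_mul_mem_scriptX0 {u v w : B}
    (hu : u ∈ Submodule.span ℂ (Set.range (extX X)))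
    (hv : v ∈ Submodule.span ℂ (Set.range (extX X)))
    (hw : w ∈ Submodule.span ℂ (Set.range (extX X))) :
    Y * (u * v * w) * Y ∈ scriptX0 X Y := by
  rw [← mul_assoc Y (u * v) w, mul_assoc _ w Y]
  exact mul_mem_scriptX0_left (mul_mul_mem_scriptX_of_mem_span hu hv)
    (mul_right_mem_scriptX0_of_mem_span hw)

lemma extX_mem_span (k : Fin (d + 1)) :
    extX X k ∈ Submodule.span ℂ (Set.range (extX X)) :=
  Submodule.subset_span ⟨k, rfl⟩

lemma commutator_extX_mem_span {c : Fin d → Fin d → Fin d → ℝ}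
    (hXlie : ∀ i j, X i * X j - X j * X i = ∑ k : Fin d, (c k i j : ℂ) • X k)
    (k l : Fin (d + 1)) :
    extX X k * extX X l - extX X l * extX X k ∈ Submodule.span ℂ (Set.range (extX X)) := by
  cases k using Fin.cases with
  | zero => simp [extX]
  | succ i =>
    cases l using Fin.cases with
    | zero => simp [extX]
    | succ j =>
      change X i * X j - X j * X i ∈ _
      rw [hXlie]
      exact sum_mem fun m _ => Submodule.smul_mem _ _ (extX_mem_span m.succ)

lemma star_extX [StarRing B] [StarModule ℂ B] (hXstar : ∀ k, star (X k) = -X k)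
    (k : Fin (d + 1)) : star (extX X k) = -extX X k := by
  cases k using Fin.cases with
  | zero => simp [extX]
  | succ i => exact hXstar i

lemma commutator_sq_mul {R : Type*} [Ring R] (x a b : R) :
    x ^ 2 * (a * b) - a * b * x ^ 2 =
      x * (x * a - a * x) * b + (x * a - a * x) * x * b +
        a * x * (x * b - b * x) + a * (x * b - b * x) * x := by
  noncomm_ring

lemma commutator_inv_mem_scriptX0 {c : Fin d → Fin d → Fin d → ℝ}
    (hXlie : ∀ i j, X i * X j - X j * X i = ∑ k : Fin d, (c k i j : ℂ) • X k)
    {A : B} (hA : A = 1 - ∑ k : Fin d, X k ^ 2) (hAY : A * Y = 1) (hYA : Y * A = 1)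
    (k l : Fin (d + 1)) :
    extX X k * extX X l * Y - Y * (extX X k * extX X l) ∈ scriptX0 X Y := by
  set p := extX X k * extX X l with hp
  have h : p * Y - Y * p = -∑ j : Fin d, Y * (X j ^ 2 * p - p * X j ^ 2) * Y := by
    calc p * Y - Y * p = Y * A * p * Y - Y * p * (A * Y) := by rw [hYA, hAY, one_mul, mul_one]
      _ = Y * (A * p - p * A) * Y := by noncomm_ring
      _ = _ := by
        rw [← Finset.sum_mul, ← Finset.mul_sum, Finset.sum_sub_distrib, ← Finset.sum_mul,
          ← Finset.mul_sum, hA]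
        noncomm_ring
  rw [h]
  refine neg_mem (sum_mem fun j _ => ?_)
  have hx : X j ∈ Submodule.span ℂ (Set.range (extX X)) := extX_mem_span j.succ
  have hk := commutator_extX_mem_span hXlie j.succ k
  have hl := commutator_extX_mem_span hXlie j.succ l
  change X j * _ - _ * X j ∈ _ at hk hl
  rw [hp, commutator_sq_mul]
  simp only [mul_add, add_mul]
  exact add_mem (add_mem (add_mem
    (mul_cubic_mul_mem_scriptX0 hx hk (extX_mem_span l))
    (mul_cubic_mul_mem_scriptX0 hk hx (extX_mem_span l)))
    (mul_cubic_mul_mem_scriptX0 (extX_mem_span k) hx hl))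
    (mul_cubic_mul_mem_scriptX0 (extX_mem_span k) hl hx)

end Helpers

lemma star_inv_eq_self {B : Type*} [Ring B] [StarRing B] {d : ℕ} {X : Fin d → B} {Y : B}
    (hXstar : ∀ k, star (X k) = -X k)
    {A : B} (hA : A = 1 - ∑ k : Fin d, X k ^ 2) (hYA : Y * A = 1) :
    star Y = Y := by
  have hstarA : star A = A := by simp [hA, hXstar]
  have h : A * star Y = 1 := by simpa [hstarA] using congrArg star hYA
  exact (left_inv_eq_right_inv hYA h).symm

/-- For all `k, l ∈ {0,…,d}` the elements `Y_{kl} − Y_{kl}*` and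
`Y_{kl} − Y_{lk}` belong to the ideal `𝒳₀`. -/
theorem statement5 {B : Type*} [Ring B] [Algebra ℂ B] [StarRing B] [StarModule ℂ B]
    (d : ℕ) (hd : 1 ≤ d)
    (c : Fin d → Fin d → Fin d → ℝ)
    (hc : ∀ k i j, c k i j = - c k j i)
    (X : Fin d → B)
    (hXstar : ∀ k, star (X k) = - X k)
    (hXlie : ∀ i j, X i * X j - X j * X i = ∑ k : Fin d, (c k i j : ℂ) • X k)
    (A Y : B) (hA : A = 1 - ∑ k : Fin d, X k ^ 2)
    (hAY : A * Y = 1) (hYA : Y * A = 1) :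
    ∀ k l : Fin (d + 1),
      Ymat X Y k l - star (Ymat X Y k l) ∈ scriptX0 X Y ∧
      Ymat X Y k l - Ymat X Y l k ∈ scriptX0 X Y := by
  intro k l
  have hcomm := commutator_extX_mem_span hXlie k l
  constructor
  · have hstar : star (Ymat X Y k l) = Y * (extX X l * extX X k) := by
      simp [Ymat, star_extX hXstar, star_inv_eq_self hXstar hA hYA]
    have hsplit : Ymat X Y k l - star (Ymat X Y k l) =
        (extX X k * extX X l * Y - Y * (extX X k * extX X l)) +
          Y * (extX X k * extX X l - extX X l * extX X k) := by
      rw [hstar, Ymat, mul_sub]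
      abel
    rw [hsplit]
    exact add_mem (commutator_inv_mem_scriptX0 hXlie hA hAY hYA k l)
      (mul_left_mem_scriptX0_of_mem_span hcomm)
  · rw [Ymat, Ymat, ← sub_mul]
    exact mul_right_mem_scriptX0_of_mem_span hcomm
end

section
/- In the setting described, Y·𝒳₀ = 𝒳₀·Y as subsets of B, and for every x ∈ 𝒳 the element Y·x − x·Y belongs to Y·𝒳₀. -/
open scoped BigOperators

section

open scoped Pointwise

variable {B : Type*} [Ring B] [Algebra ℂ B] {d : ℕ} {X : Fin d → B} {A Y : B}

/-- The linear span of `X₀, X₁, …, X_d`. -/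
noncomputable def spanX (X : Fin d → B) : Submodule ℂ B :=
  Submodule.span ℂ (Set.range (extX X))

lemma extX_mem_spanX (X : Fin d → B) (k : Fin (d + 1)) : extX X k ∈ spanX X :=
  Submodule.subset_span ⟨k, rfl⟩

lemma X_mem_spanX (X : Fin d → B) (k : Fin d) : X k ∈ spanX X :=
  extX_mem_spanX X k.succ

lemma one_mem_spanX (X : Fin d → B) : (1 : B) ∈ spanX X := by
  have h := (spanX X).smul_mem (-Complex.I) (extX_mem_spanX X 0)
  have h0 : extX X 0 = Complex.I • (1 : B) := rfl
  simpa [h0, smul_smul] using h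

lemma mem_sq_of_mem_spanX {v : B} (hv : v ∈ spanX X) : v ∈ spanX X * spanX X := by
  simpa using Submodule.mul_mem_mul hv (one_mem_spanX X)

/-- Elements of degree at most two, multiplied by `Y` on either side, lie in `𝒳`. -/
lemma mul_mem_scriptX_of_mem_sq (Y : B) {s : B} (hs : s ∈ spanX X * spanX X) :
    s * Y ∈ scriptX X Y ∧ Y * s ∈ scriptX X Y := by
  rw [spanX, Submodule.span_mul_span] at hs
  induction hs using Submodule.span_induction with
  | mem x hx =>
    obtain ⟨_, ⟨k, rfl⟩, _, ⟨l, rfl⟩, rfl⟩ := hx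
    exact ⟨Algebra.subset_adjoin ⟨k, l, Or.inl rfl⟩, Algebra.subset_adjoin ⟨l, k, Or.inr rfl⟩⟩
  | zero => simp [zero_mem]
  | add x y _ _ hx hy =>
    rw [add_mul, mul_add]
    exact ⟨add_mem hx.1 hy.1, add_mem hx.2 hy.2⟩
  | smul a x _ hx =>
    rw [smul_mul_assoc, mul_smul_comm]
    exact ⟨Subalgebra.smul_mem _ hx.1 a, Subalgebra.smul_mem _ hx.2 a⟩

lemma mul_mem_scriptX0_left_s7 {x w : B} (hx : x ∈ scriptX X Y) (hw : w ∈ scriptX0 X Y) :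
    x * w ∈ scriptX0 X Y := by
  induction hw using AddSubgroup.closure_induction with
  | mem w hw =>
    obtain ⟨y, hy, z, hz, k, h⟩ := hw
    refine AddSubgroup.subset_closure ⟨x * y, mul_mem hx hy, z, hz, k, ?_⟩
    rcases h with rfl | rfl <;> simp [mul_assoc]
  | zero => simp [zero_mem]
  | add a b _ _ ha hb => rw [mul_add]; exact add_mem ha hb
  | neg a _ ha => rw [mul_neg]; exact neg_mem ha

lemma mul_mem_scriptX0_right {x w : B} (hw : w ∈ scriptX0 X Y) (hx : x ∈ scriptX X Y) :
    w * x ∈ scriptX0 X Y := by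
  induction hw using AddSubgroup.closure_induction with
  | mem w hw =>
    obtain ⟨y, hy, z, hz, k, h⟩ := hw
    refine AddSubgroup.subset_closure ⟨y, hy, z * x, mul_mem hz hx, k, ?_⟩
    rcases h with rfl | rfl <;> simp [mul_assoc]
  | zero => simp [zero_mem]
  | add a b _ _ ha hb => rw [add_mul]; exact add_mem ha hb
  | neg a _ ha => rw [neg_mul]; exact neg_mem ha

lemma smul_mem_scriptX0_s7 (a : ℂ) {w : B} (hw : w ∈ scriptX0 X Y) : a • w ∈ scriptX0 X Y := by
  rw [Algebra.smul_def]
  exact mul_mem_scriptX0_left_s7 (Subalgebra.algebraMap_mem _ a) hw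

lemma mul_mem_scriptX0_of_mem_spanX (Y : B) {v : B} (hv : v ∈ spanX X) :
    v * Y ∈ scriptX0 X Y ∧ Y * v ∈ scriptX0 X Y := by
  induction hv using Submodule.span_induction with
  | mem x hx =>
    obtain ⟨k, rfl⟩ := hx
    exact ⟨AddSubgroup.subset_closure ⟨1, one_mem _, 1, one_mem _, k, by simp⟩,
      AddSubgroup.subset_closure ⟨1, one_mem _, 1, one_mem _, k, by simp⟩⟩
  | zero => simp [zero_mem]
  | add x y _ _ hx hy =>
    rw [add_mul, mul_add]
    exact ⟨add_mem hx.1 hy.1, add_mem hx.2 hy.2⟩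
  | smul a x _ hx =>
    rw [smul_mul_assoc, mul_smul_comm]
    exact ⟨smul_mem_scriptX0_s7 a hx.1, smul_mem_scriptX0_s7 a hx.2⟩

lemma mem_scriptX0 (X : Fin d → B) (Y : B) : Y ∈ scriptX0 X Y := by
  simpa using (mul_mem_scriptX0_of_mem_spanX Y (one_mem_spanX X)).1

/-- If brackets of the `X i` lie in the span, the commutator of `A` with an element of the span
has degree at most two. -/
lemma commutator_mem_sq (hX : ∀ i j, X i * X j - X j * X i ∈ spanX X)
    (hA : A = 1 - ∑ k : Fin d, X k ^ 2) {v : B} (hv : v ∈ spanX X) :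
    v * A - A * v ∈ spanX X * spanX X := by
  induction hv using Submodule.span_induction with
  | mem x hx =>
    obtain ⟨k, rfl⟩ := hx
    cases k using Fin.cases with
    | zero => simp [extX]
    | succ k =>
      have h : extX X k.succ * A - A * extX X k.succ =
          ∑ j, (X j * (X j * X k - X k * X j) + (X j * X k - X k * X j) * X j) := by
        change X k * A - A * X k = _
        rw [hA, mul_sub, sub_mul, Finset.mul_sum, Finset.sum_mul, mul_one, one_mul,
          sub_sub_sub_cancel_left, ← Finset.sum_sub_distrib]
        exact Finset.sum_congr rfl fun j _ => by noncomm_ring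
      rw [h]
      exact Submodule.sum_mem _ fun j _ => add_mem
        (Submodule.mul_mem_mul (X_mem_spanX X j) (hX j k))
        (Submodule.mul_mem_mul (hX j k) (X_mem_spanX X j))
  | zero => simp
  | add x y _ _ hx hy =>
    convert add_mem hx hy using 1
    noncomm_ring
  | smul a x _ hx =>
    rw [smul_mul_assoc, mul_smul_comm, ← smul_sub]
    exact Submodule.smul_mem _ a hx

lemma commutator_mem_cube (hV : ∀ v ∈ spanX X, v * A - A * v ∈ spanX X * spanX X)
    {s : B} (hs : s ∈ spanX X * spanX X) :
    s * A - A * s ∈ spanX X * spanX X * spanX X := by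
  induction hs using Submodule.mul_induction_on' with
  | mem_mul_mem v hv w hw =>
    have h : v * w * A - A * (v * w) = v * (w * A - A * w) + (v * A - A * v) * w := by
      noncomm_ring
    rw [h]
    refine add_mem ?_ (Submodule.mul_mem_mul (hV v hv) hw)
    rw [mul_assoc]
    exact Submodule.mul_mem_mul hv (hV w hw)
  | add x _ y _ hx hy =>
    convert add_mem hx hy using 1
    noncomm_ring

/-- Elements of degree at most three, multiplied by two factors `Y`, lie in `𝒳₀`. -/
lemma cube_mem_scriptX0 (hV : ∀ v ∈ spanX X, v * A - A * v ∈ spanX X * spanX X)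
    (hAY : A * Y = 1) (hYA : Y * A = 1) {t : B} (ht : t ∈ spanX X * spanX X * spanX X) :
    t * Y * Y ∈ scriptX0 X Y ∧ Y * t * Y ∈ scriptX0 X Y ∧ Y * Y * t ∈ scriptX0 X Y := by
  have hcomm (u : B) : u * Y = Y * u - Y * (u * A - A * u) * Y := by
    have h1 : Y * (u * A - A * u) * Y = Y * u * (A * Y) - (Y * A) * u * Y := by noncomm_ring
    rw [h1, hAY, hYA]
    noncomm_ring
  refine ⟨?_, ?_, ?_⟩
  · induction ht using Submodule.mul_induction_on' with
    | mem_mul_mem s hs u hu =>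
      have h : s * u * Y * Y = s * Y * (u * Y) - s * Y * (((u * A - A * u) * Y) * Y) := by
        calc s * u * Y * Y = s * (Y * u - Y * (u * A - A * u) * Y) * Y := by
              rw [← hcomm, mul_assoc s u Y]
          _ = _ := by noncomm_ring
      rw [h]
      have hs' := (mul_mem_scriptX_of_mem_sq Y hs).1
      exact sub_mem (mul_mem_scriptX0_left_s7 hs' (mul_mem_scriptX0_of_mem_spanX Y hu).1)
        (mul_mem_scriptX0_left_s7 hs' (mul_mem_scriptX0_left_s7
          (mul_mem_scriptX_of_mem_sq Y (hV u hu)).1 (mem_scriptX0 X Y)))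
    | add x _ y _ hx hy => rw [add_mul, add_mul]; exact add_mem hx hy
  · induction ht using Submodule.mul_induction_on' with
    | mem_mul_mem s hs u hu =>
      rw [← mul_assoc, mul_assoc]
      exact mul_mem_scriptX0_left_s7 (mul_mem_scriptX_of_mem_sq Y hs).2
        (mul_mem_scriptX0_of_mem_spanX Y hu).1
    | add x _ y _ hx hy => rw [mul_add, add_mul]; exact add_mem hx hy
  · rw [mul_assoc (spanX X)] at ht
    induction ht using Submodule.mul_induction_on' with
    | mem_mul_mem u hu s hs =>
      have h : Y * Y * (u * s) = Y * u * (Y * s) + Y * (Y * (u * A - A * u)) * (Y * s) := by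
        have h1 : Y * u * (Y * s) = Y * (u * Y) * s := by noncomm_ring
        rw [h1, hcomm u]
        noncomm_ring
      rw [h]
      have hs' := (mul_mem_scriptX_of_mem_sq Y hs).2
      exact add_mem (mul_mem_scriptX0_right (mul_mem_scriptX0_of_mem_spanX Y hu).2 hs')
        (mul_mem_scriptX0_right (mul_mem_scriptX0_right (mem_scriptX0 X Y)
          (mul_mem_scriptX_of_mem_sq Y (hV u hu)).2) hs')
    | add x _ y _ hx hy => rw [mul_add]; exact add_mem hx hy

lemma mem_scriptX_of_mem_scriptX0 {w : B} (hw : w ∈ scriptX0 X Y) : w ∈ scriptX X Y := by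
  induction hw using AddSubgroup.closure_induction with
  | mem w hw =>
    obtain ⟨y, hy, z, hz, k, h⟩ := hw
    have hk := mul_mem_scriptX_of_mem_sq Y (mem_sq_of_mem_spanX (extX_mem_spanX X k))
    rcases h with rfl | rfl
    · exact mul_mem (mul_mem hy hk.1) hz
    · exact mul_mem (mul_mem hy hk.2) hz
  | zero => exact zero_mem _
  | add a b _ _ ha hb => exact add_mem ha hb
  | neg a _ ha => exact neg_mem ha

/-- The commutator of `A` with an element of `𝒳` is sent into `𝒳₀` by multiplication by `Y` on
either side. -/
lemma commutator_mul_mem_scriptX0 (hV : ∀ v ∈ spanX X, v * A - A * v ∈ spanX X * spanX X)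
    (hAY : A * Y = 1) (hYA : Y * A = 1) {x : B} (hx : x ∈ scriptX X Y) :
    (x * A - A * x) * Y ∈ scriptX0 X Y ∧ Y * (x * A - A * x) ∈ scriptX0 X Y := by
  induction hx using Algebra.adjoin_induction with
  | mem x hx =>
    obtain ⟨k, l, h⟩ := hx
    rcases h with rfl | rfl
    · have hs := Submodule.mul_mem_mul (extX_mem_spanX X k) (extX_mem_spanX X l)
      generalize extX X k * extX X l = s at hs ⊢
      have h : s * Y * A - A * (s * Y) = (s * A - A * s) * Y := by
        simp only [sub_mul, mul_assoc, hAY, hYA]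
      obtain ⟨h1, h2, -⟩ := cube_mem_scriptX0 hV hAY hYA (commutator_mem_cube hV hs)
      rw [h, ← mul_assoc]
      exact ⟨h1, h2⟩
    · have hs := Submodule.mul_mem_mul (extX_mem_spanX X l) (extX_mem_spanX X k)
      generalize extX X l * extX X k = s at hs ⊢
      have h : Y * s * A - A * (Y * s) = Y * (s * A - A * s) := by
        simp only [mul_sub, ← mul_assoc, hAY, hYA]
      obtain ⟨-, h2, h3⟩ := cube_mem_scriptX0 hV hAY hYA (commutator_mem_cube hV hs)
      rw [h, ← mul_assoc]
      exact ⟨h2, h3⟩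
  | algebraMap r => simp [Algebra.commutes r A, zero_mem]
  | add x y _ _ hx hy =>
    constructor
    · convert add_mem hx.1 hy.1 using 1
      noncomm_ring
    · convert add_mem hx.2 hy.2 using 1
      noncomm_ring
  | mul x y hx' hy' hx hy =>
    -- `x ↦ x A - A x` is a derivation; insert `Y A = 1` or `A Y = 1` between the factors.
    have hl : (x * y * A - A * (x * y)) * Y =
        x * ((y * A - A * y) * Y) + (x * A - A * x) * Y * (y - (y * A - A * y) * Y) := by
      have h1 : y - (y * A - A * y) * Y = A * y * Y := by
        rw [sub_mul, mul_assoc y, hAY, mul_one, sub_sub_cancel]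
      have h2 : (x * A - A * x) * Y * (A * y * Y) = (x * A - A * x) * (Y * A) * y * Y := by
        noncomm_ring
      rw [h1, h2, hYA]
      noncomm_ring
    have hr : Y * (x * y * A - A * (x * y)) =
        (x + Y * (x * A - A * x)) * (Y * (y * A - A * y)) + Y * (x * A - A * x) * y := by
      have h1 : x + Y * (x * A - A * x) = Y * x * A := by
        rw [mul_sub, ← mul_assoc, ← mul_assoc, hYA, one_mul, add_sub_cancel]
      have h2 : Y * x * A * (Y * (y * A - A * y)) = Y * x * (A * Y) * (y * A - A * y) := by
        noncomm_ring
      rw [h1, h2, hAY]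
      noncomm_ring
    rw [hl, hr]
    exact ⟨add_mem (mul_mem_scriptX0_left_s7 hx' hy.1)
        (mul_mem_scriptX0_right hx.1 (sub_mem hy' (mem_scriptX_of_mem_scriptX0 hy.1))),
      add_mem (mul_mem_scriptX0_left_s7 (add_mem hx' (mem_scriptX_of_mem_scriptX0 hx.2)) hy.2)
        (mul_mem_scriptX0_right hx.2 hy')⟩

end

/-- `Y·𝒳₀ = 𝒳₀·Y` as subsets of `B`, and for every `x ∈ 𝒳` the
commutator `Y·x − x·Y` belongs to `Y·𝒳₀`. -/
theorem statement7 {B : Type*} [Ring B] [Algebra ℂ B] [StarRing B] [StarModule ℂ B]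
    (d : ℕ) (hd : 1 ≤ d)
    (c : Fin d → Fin d → Fin d → ℝ)
    (hc : ∀ k i j, c k i j = - c k j i)
    (X : Fin d → B)
    (hXstar : ∀ k, star (X k) = - X k)
    (hXlie : ∀ i j, X i * X j - X j * X i = ∑ k : Fin d, (c k i j : ℂ) • X k)
    (A Y : B) (hA : A = 1 - ∑ k : Fin d, X k ^ 2)
    (hAY : A * Y = 1) (hYA : Y * A = 1) :
    ({b : B | ∃ x ∈ scriptX0 X Y, b = Y * x} = {b : B | ∃ x ∈ scriptX0 X Y, b = x * Y}) ∧
    (∀ x ∈ scriptX X Y, Y * x - x * Y ∈ {b : B | ∃ w ∈ scriptX0 X Y, b = Y * w}) := by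
  have hX (i j : Fin d) : X i * X j - X j * X i ∈ spanX X := by
    rw [hXlie]
    exact Submodule.sum_mem _ fun k _ => Submodule.smul_mem _ _ (X_mem_spanX X k)
  have key {x : B} (hx : x ∈ scriptX X Y) :=
    commutator_mul_mem_scriptX0 (fun v hv => commutator_mem_sq hX hA hv) hAY hYA hx
  have hleft (x : B) : Y * x - x * Y = Y * ((x * A - A * x) * Y) := by
    have h : Y * ((x * A - A * x) * Y) = Y * x * (A * Y) - Y * A * x * Y := by noncomm_ring
    rw [h, hAY, hYA, mul_one, one_mul]
  have hright (x : B) : Y * x - x * Y = Y * (x * A - A * x) * Y := by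
    rw [hleft, mul_assoc]
  refine ⟨Set.ext fun b => ⟨?_, ?_⟩, fun x hx => ⟨_, (key hx).1, hleft x⟩⟩
  · rintro ⟨x, hx, rfl⟩
    refine ⟨x + Y * (x * A - A * x), add_mem hx (key (mem_scriptX_of_mem_scriptX0 hx)).2, ?_⟩
    rw [add_mul, ← hright, add_sub_cancel]
  · rintro ⟨x, hx, rfl⟩
    refine ⟨x - (x * A - A * x) * Y, sub_mem hx (key (mem_scriptX_of_mem_scriptX0 hx)).1, ?_⟩
    rw [mul_sub, ← hleft, sub_sub_cancel]
end

section
/- In the setting described, for all k, l ∈ {1,…,d} the following identities hold in B: A·X_k − X_k·A = Σ_{i,j=1}^d b^j_{ki} X_i X_j, and A·X_kX_l − X_kX_l·A = Σ_{i,j=1}^d b^j_{ki} X_i X_j X_l + Σ_{i,j=1}^d b^j_{li} X_k X_i X_j. Equivalently, X_k·Y − Y·X_k = Σ_{i,j=1}^d b^j_{ki} Y X_i X_j Y and X_kX_l·Y − Y·X_kX_l = Σ_{i,j=1}^d b^j_{ki} Y X_i X_j X_l Y + Σ_{i,j=1}^d b^j_{li} Y X_k X_i X_j Y. -/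
open scoped BigOperators

/-- Commutators with an invertible element and with its inverse determine each other. -/
theorem commutator_inverse_eq {R : Type*} [Ring R] {a y : R} (hay : a * y = 1) (hya : y * a = 1)
    (x : R) : x * y - y * x = y * (a * x - x * a) * y := by
  calc x * y - y * x = y * a * x * y - y * x * (a * y) := by rw [hya, hay, one_mul, mul_one]
    _ = y * (a * x - x * a) * y := by noncomm_ring

/-- The commutator of a generator with `1 - ∑ i, X i ^ 2`, for generators closed under
commutators with structure constants `c`. -/
theorem commutator_one_sub_sum_sq {B ι : Type*} [Fintype ι] [Ring B] [Algebra ℂ B]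
    (c : ι → ι → ι → ℝ) (X : ι → B)
    (hX : ∀ i j, X i * X j - X j * X i = ∑ k, (c k i j : ℂ) • X k) (k : ι) :
    (1 - ∑ i, X i ^ 2) * X k - X k * (1 - ∑ i, X i ^ 2)
      = ∑ i, ∑ j, ((c j k i + c i k j : ℝ) : ℂ) • (X i * X j) := by
  calc (1 - ∑ i, X i ^ 2) * X k - X k * (1 - ∑ i, X i ^ 2)
      = ∑ i, (X k * X i ^ 2 - X i ^ 2 * X k) := by
        rw [Finset.sum_sub_distrib, ← Finset.mul_sum, ← Finset.sum_mul]
        noncomm_ring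
    _ = ∑ i, (X i * (X k * X i - X i * X k) + (X k * X i - X i * X k) * X i) :=
        Finset.sum_congr rfl fun i _ => by noncomm_ring
    _ = (∑ i, ∑ j, (c j k i : ℂ) • (X i * X j)) + ∑ i, ∑ j, (c j k i : ℂ) • (X j * X i) := by
        simp only [hX, Finset.mul_sum, Finset.sum_mul, mul_smul_comm, smul_mul_assoc,
          Finset.sum_add_distrib]
    _ = ∑ i, ∑ j, ((c j k i + c i k j : ℝ) : ℂ) • (X i * X j) := by
        rw [Finset.sum_comm (f := fun i j => (c j k i : ℂ) • (X j * X i))]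
        simp only [Complex.ofReal_add, add_smul, Finset.sum_add_distrib]

/-- In the setting of the paper, for all `k, l ∈ {1,…,d}`:
`A X_k − X_k A = Σ_{i,j} b^j_{ki} X_i X_j`,
`A X_k X_l − X_k X_l A = Σ_{i,j} b^j_{ki} X_i X_j X_l + Σ_{i,j} b^j_{li} X_k X_i X_j`,
and equivalently
`X_k Y − Y X_k = Σ_{i,j} b^j_{ki} Y X_i X_j Y`,
`X_k X_l Y − Y X_k X_l = Σ_{i,j} b^j_{ki} Y X_i X_j X_l Y + Σ_{i,j} b^j_{li} Y X_k X_i X_j Y`,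
where `b^j_{ki} = c^j_{ki} + c^i_{kj}`. -/
theorem statement8 {B : Type*} [Ring B] [Algebra ℂ B] [StarRing B] [StarModule ℂ B]
    (d : ℕ) (hd : 1 ≤ d)
    (c : Fin d → Fin d → Fin d → ℝ)
    (hc : ∀ k i j, c k i j = - c k j i)
    (X : Fin d → B)
    (hXstar : ∀ k, star (X k) = - X k)
    (hXlie : ∀ i j, X i * X j - X j * X i = ∑ k : Fin d, (c k i j : ℂ) • X k)
    (A Y : B) (hA : A = 1 - ∑ k : Fin d, X k ^ 2)
    (hAY : A * Y = 1) (hYA : Y * A = 1) :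
    ∀ k l : Fin d,
      (A * X k - X k * A
        = ∑ i : Fin d, ∑ j : Fin d, ((c j k i + c i k j : ℝ) : ℂ) • (X i * X j)) ∧
      (A * (X k * X l) - X k * X l * A
        = (∑ i : Fin d, ∑ j : Fin d, ((c j k i + c i k j : ℝ) : ℂ) • (X i * X j * X l))
          + ∑ i : Fin d, ∑ j : Fin d, ((c j l i + c i l j : ℝ) : ℂ) • (X k * (X i * X j))) ∧
      (X k * Y - Y * X k
        = ∑ i : Fin d, ∑ j : Fin d, ((c j k i + c i k j : ℝ) : ℂ) • (Y * (X i * X j) * Y)) ∧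
      (X k * X l * Y - Y * (X k * X l)
        = (∑ i : Fin d, ∑ j : Fin d, ((c j k i + c i k j : ℝ) : ℂ) • (Y * (X i * X j * X l) * Y))
          + ∑ i : Fin d, ∑ j : Fin d,
              ((c j l i + c i l j : ℝ) : ℂ) • (Y * (X k * (X i * X j)) * Y)) := by
  have hcomm (k : Fin d) : A * X k - X k * A
      = ∑ i : Fin d, ∑ j : Fin d, ((c j k i + c i k j : ℝ) : ℂ) • (X i * X j) := by
    rw [hA]
    exact commutator_one_sub_sum_sq c X hXlie k
  intro k l
  have hprod : A * (X k * X l) - X k * X l * A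
      = (∑ i : Fin d, ∑ j : Fin d, ((c j k i + c i k j : ℝ) : ℂ) • (X i * X j * X l))
        + ∑ i : Fin d, ∑ j : Fin d, ((c j l i + c i l j : ℝ) : ℂ) • (X k * (X i * X j)) := by
    calc A * (X k * X l) - X k * X l * A
        = (A * X k - X k * A) * X l + X k * (A * X l - X l * A) := by noncomm_ring
      _ = _ := by
        simp only [hcomm, Finset.mul_sum, Finset.sum_mul, mul_smul_comm, smul_mul_assoc]
  refine ⟨hcomm k, hprod, ?_, ?_⟩
  · rw [commutator_inverse_eq hAY hYA, hcomm]
    simp only [Finset.mul_sum, Finset.sum_mul, mul_smul_comm, smul_mul_assoc]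
  · rw [commutator_inverse_eq hAY hYA, hprod]
    simp only [mul_add, add_mul, Finset.mul_sum, Finset.sum_mul, mul_smul_comm, smul_mul_assoc]
end

section
/- In the setting described, for every n ∈ ℕ, n ≥ 1, and all indices k₁, …, k_{2n} ∈ {0,…,d}, the element Yⁿ · X_{k₁} X_{k₂} ⋯ X_{k_{2n}} belongs to the subalgebra 𝒳. -/
open scoped BigOperators

/-- Commuting with `a` raises the degree by at most one if it does so on generators. -/
lemma commutator_mem_pow_succ {R B : Type*} [CommRing R] [Ring B] [Algebra R B]
    {M : Submodule R B} {a : B} (ha : ∀ x ∈ M, x * a - a * x ∈ M ^ 2) (m : ℕ) :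
    ∀ p ∈ M ^ m, p * a - a * p ∈ M ^ (m + 1) := by
  induction m with
  | zero =>
    intro p hp
    obtain ⟨r, rfl⟩ := Submodule.mem_one.mp (by simpa using hp)
    rw [Algebra.commutes, sub_self]
    exact Submodule.zero_mem _
  | succ m ih =>
    intro p hp
    rw [pow_succ'] at hp
    induction hp using Submodule.mul_induction_on' with
    | mem_mul_mem x hx q hq =>
      have h : x * q * a - a * (x * q) = x * (q * a - a * q) + (x * a - a * x) * q := by
        noncomm_ring
      rw [h]
      refine Submodule.add_mem _ ?_ ?_
      · rw [pow_succ']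
        exact Submodule.mul_mem_mul hx (ih q hq)
      · rw [show m + 1 + 1 = 2 + m by ring, pow_add]
        exact Submodule.mul_mem_mul (ha x hx) hq
    | add x _ y _ hx hy =>
      rw [add_mul, mul_add, add_sub_add_comm]
      exact Submodule.add_mem _ hx hy

/-- Degree induction step: the power of `y` goes up by one as the degree goes up by two. -/
lemma pow_succ_mul_mem_of_degree {R B : Type*} [CommRing R] [Ring B] [Algebra R B]
    {M : Submodule R B} {S : Subalgebra R B} {a y : B} (hay : a * y = 1) (hya : y * a = 1)
    (ha : ∀ x ∈ M, x * a - a * x ∈ M ^ 2) (hS : ∀ q ∈ M ^ 2, y * q ∈ S) {n m : ℕ}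
    (h₁ : ∀ p ∈ M ^ m, y ^ n * p ∈ S) (h₂ : ∀ p ∈ M ^ (m + 1), y ^ (n + 1) * p ∈ S) :
    ∀ p ∈ M ^ (m + 2), y ^ (n + 1) * p ∈ S := by
  intro p hp
  rw [pow_add] at hp
  induction hp using Submodule.mul_induction_on' with
  | mem_mul_mem p hp q hq =>
    have h : y ^ (n + 1) * (p * q) =
        y ^ n * p * (y * q) + y ^ (n + 1) * (p * a - a * p) * (y * q) := by
      have e₁ : y ^ (n + 1) * (p * a) * (y * q) = y ^ (n + 1) * (p * q) := by
        calc _ = y ^ (n + 1) * p * (a * y) * q := by simp only [mul_assoc]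
          _ = _ := by rw [hay, mul_one, mul_assoc]
      have e₂ : y ^ (n + 1) * (a * p) * (y * q) = y ^ n * p * (y * q) := by
        calc _ = y ^ n * (y * a) * p * (y * q) := by simp only [pow_succ, mul_assoc]
          _ = _ := by rw [hya, mul_one]
      rw [mul_sub, sub_mul, e₁, e₂, add_sub_cancel]
    rw [h]
    exact S.add_mem (S.mul_mem (h₁ p hp) (hS q hq))
      (S.mul_mem (h₂ _ (commutator_mem_pow_succ ha m p hp)) (hS q hq))
  | add u _ v _ hu hv =>
    rw [mul_add]
    exact S.add_mem hu hv

/-- If `y = a⁻¹` and `y M² ⊆ S`, then `yⁿ M²ⁿ ⊆ S` for every `n`. -/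
lemma pow_mul_mem_of_mem_pow {R B : Type*} [CommRing R] [Ring B] [Algebra R B]
    {M : Submodule R B} {S : Subalgebra R B} {a y : B} (hay : a * y = 1) (hya : y * a = 1)
    (hM : 1 ≤ M) (ha : ∀ x ∈ M, x * a - a * x ∈ M ^ 2) (hS : ∀ q ∈ M ^ 2, y * q ∈ S) {n : ℕ}
    (hn : 1 ≤ n) : ∀ p ∈ M ^ (2 * n), y ^ n * p ∈ S := by
  have hmono {i j : ℕ} (hij : i ≤ j) : M ^ i ≤ M ^ j := pow_le_pow_right₀ hM hij
  have hy : y ∈ S := by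
    have h1 : (1 : B) ∈ M ^ 2 := hmono (Nat.zero_le 2) (by simpa using ⟨1, map_one _⟩)
    simpa using hS 1 h1
  induction n, hn using Nat.le_induction with
  | base => simpa using hS
  | succ n hn ih =>
    have h₀ : ∀ p ∈ M ^ (2 * n), y ^ (n + 1) * p ∈ S := fun p hp => by
      rw [pow_succ', mul_assoc]
      exact S.mul_mem hy (ih p hp)
    obtain ⟨m, hm⟩ : ∃ m, 2 * n = m + 1 := ⟨2 * n - 1, by omega⟩
    refine pow_succ_mul_mem_of_degree (m := 2 * n) hay hya ha hS ih ?_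
    rw [hm] at ih h₀ ⊢
    exact pow_succ_mul_mem_of_degree hay hya ha hS (fun p hp => ih p (hmono m.le_succ hp)) h₀

/-- If all `X k` and all commutators `[x, X k]` lie in `M`, then the commutator of `x` with
`1 - ∑ X k ^ 2` lies in `M ^ 2`. -/
lemma commutator_one_sub_sum_sq_mem {R B ι : Type*} [CommRing R] [Ring B] [Algebra R B]
    [Fintype ι] {M : Submodule R B} {X : ι → B} (hX : ∀ k, X k ∈ M) {x : B}
    (hx : ∀ k, x * X k - X k * x ∈ M) :
    x * (1 - ∑ k, X k ^ 2) - (1 - ∑ k, X k ^ 2) * x ∈ M ^ 2 := by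
  have h : x * (1 - ∑ k, X k ^ 2) - (1 - ∑ k, X k ^ 2) * x =
      -∑ k, ((x * X k - X k * x) * X k + X k * (x * X k - X k * x)) := by
    have e : ∀ k, (x * X k - X k * x) * X k + X k * (x * X k - X k * x) =
        x * X k ^ 2 - X k ^ 2 * x := fun k => by noncomm_ring
    simp only [e, Finset.sum_sub_distrib, ← Finset.mul_sum, ← Finset.sum_mul]
    noncomm_ring
  rw [h, sq]
  exact Submodule.neg_mem _ (Submodule.sum_mem _ fun k _ => Submodule.add_mem _
    (Submodule.mul_mem_mul (hx k) (hX k)) (Submodule.mul_mem_mul (hX k) (hx k)))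

/-- For every `n ≥ 1` and all indices `k₁, …, k_{2n} ∈ {0,…,d}`, the
element `Yⁿ X_{k₁} ⋯ X_{k_{2n}}` belongs to the subalgebra `𝒳`. -/
theorem statement10 {B : Type*} [Ring B] [Algebra ℂ B] [StarRing B] [StarModule ℂ B]
    (d : ℕ) (hd : 1 ≤ d)
    (c : Fin d → Fin d → Fin d → ℝ)
    (hc : ∀ k i j, c k i j = - c k j i)
    (X : Fin d → B)
    (hXstar : ∀ k, star (X k) = - X k)
    (hXlie : ∀ i j, X i * X j - X j * X i = ∑ k : Fin d, (c k i j : ℂ) • X k)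
    (A Y : B) (hA : A = 1 - ∑ k : Fin d, X k ^ 2)
    (hAY : A * Y = 1) (hYA : Y * A = 1) :
    ∀ n : ℕ, 1 ≤ n → ∀ k : Fin (2 * n) → Fin (d + 1),
      Y ^ n * (List.ofFn fun i => extX X (k i)).prod ∈ scriptX X Y := by
  intro n hn k
  set M : Submodule ℂ B := Submodule.span ℂ (Set.range (extX X)) with hMdef
  have hgen (i : Fin (d + 1)) : extX X i ∈ M := Submodule.subset_span ⟨i, rfl⟩
  have hX (i : Fin d) : X i ∈ M := by simpa [extX] using hgen i.succ
  have hone : (1 : B) ∈ M := by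
    have h := M.smul_mem (-Complex.I) (hgen 0)
    simpa [extX, smul_smul] using h
  have hcomm : ∀ x ∈ M, ∀ j, x * X j - X j * x ∈ M := by
    intro x hx j
    induction hx using Submodule.span_induction with
    | mem x hx =>
      obtain ⟨i, rfl⟩ := hx
      refine Fin.cases ?_ (fun i => ?_) i
      · simp [extX]
      · simp only [extX, Fin.cases_succ, hXlie]
        exact M.sum_mem fun l _ => M.smul_mem _ (hX l)
    | zero => simp
    | add x y _ _ hx hy =>
      rw [add_mul, mul_add, add_sub_add_comm]
      exact M.add_mem hx hy
    | smul r x _ hx =>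
      rw [smul_mul_assoc, mul_smul_comm, ← smul_sub]
      exact M.smul_mem r hx
  have hS : ∀ q ∈ M ^ 2, Y * q ∈ scriptX X Y := by
    have hle : M ^ 2 ≤ (Subalgebra.toSubmodule (scriptX X Y)).comap (LinearMap.mulLeft ℂ Y) := by
      rw [sq, hMdef, Submodule.span_mul_span, Submodule.span_le]
      rintro _ ⟨_, ⟨l, rfl⟩, _, ⟨k, rfl⟩, rfl⟩
      exact Algebra.subset_adjoin ⟨k, l, Or.inr rfl⟩
    exact fun q hq => hle hq
  refine pow_mul_mem_of_mem_pow hAY hYA (Submodule.one_le.mpr hone)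
    (fun x hx => hA ▸ commutator_one_sub_sum_sq_mem hX (hcomm x hx)) hS hn _ ?_
  have hword : ∀ (m : ℕ) (f : Fin m → Fin (d + 1)),
      (List.ofFn fun i => extX X (f i)).prod ∈ M ^ m := by
    intro m
    induction m with
    | zero => simpa using ⟨1, map_one _⟩
    | succ m ih =>
      intro f
      rw [List.ofFn_succ, List.prod_cons, pow_succ']
      exact Submodule.mul_mem_mul (hgen _) (ih _)
  exact hword _ k
end

section
/- In the setting described, the following identity holds in B: Y_{00}² + 2 Σ_{k=1}^d Y_{k0}* Y_{k0} + Σ_{k,l=1}^d (Y_{kl} + (i/2) Σ_{j=1}^d b^k_{jl} Y_{j0})* (Y_{kl} + (i/2) Σ_{j=1}^d b^k_{jl} Y_{j0}) = 1 + (1/4) Σ_{k,l=1}^d (Σ_{j=1}^d b^k_{jl} Y_{j0})* (Σ_{j=1}^d b^k_{jl} Y_{j0}). -/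
open scoped BigOperators

section LieSums

variable {B : Type*} [Ring B] [Algebra ℂ B] {d : ℕ}

/-- The combination `∑ j, (c^k_{jl} + c^l_{jk}) X_j` of generators. -/
noncomputable def symLieSum (c : Fin d → Fin d → Fin d → ℝ) (X : Fin d → B) (k l : Fin d) : B :=
  ∑ j : Fin d, ((c k j l + c l j k : ℝ) : ℂ) • X j

theorem sum_symLieSum_mul_mul (c : Fin d → Fin d → Fin d → ℝ) (X : Fin d → B)
    (hX : ∀ i j, X i * X j - X j * X i = ∑ k : Fin d, (c k i j : ℂ) • X k) :
    ∑ k, ∑ l, symLieSum c X k l * (X k * X l)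
      = ∑ k, ∑ l, (X k * X k * X l * X l - X k * X l * X l * X k) := by
  have h₁ : ∑ k, ∑ l, ∑ j, (c k j l : ℂ) • (X j * (X k * X l))
      = ∑ j, ∑ l, X j * (X j * X l - X l * X j) * X l := by
    simp only [hX, Finset.mul_sum, Finset.sum_mul, mul_smul_comm, smul_mul_assoc, mul_assoc]
    rw [Finset.sum_comm_cycle]
    exact Finset.sum_congr rfl fun _ _ => Finset.sum_comm
  have h₂ : ∑ k, ∑ l, ∑ j, (c l j k : ℂ) • (X j * (X k * X l))
      = ∑ j, ∑ k, X j * X k * (X j * X k - X k * X j) := by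
    simp only [hX, Finset.mul_sum, mul_smul_comm, mul_assoc]
    rw [Finset.sum_comm_cycle]
  simp only [symLieSum, Finset.sum_mul, smul_mul_assoc, Complex.ofReal_add, add_smul, add_mul,
    Finset.sum_add_distrib, h₁, h₂]
  simp only [← Finset.sum_add_distrib]
  exact Finset.sum_congr rfl fun _ _ => Finset.sum_congr rfl fun _ _ => by noncomm_ring

theorem sum_mul_mul_symLieSum (c : Fin d → Fin d → Fin d → ℝ) (X : Fin d → B)
    (hX : ∀ i j, X i * X j - X j * X i = ∑ k : Fin d, (c k i j : ℂ) • X k) :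
    ∑ k, ∑ l, X l * X k * symLieSum c X k l
      = ∑ k, ∑ l, (X k * X l * X l * X k - X l * X l * X k * X k) := by
  have h₁ : ∑ k, ∑ l, ∑ j, (c k j l : ℂ) • (X l * X k * X j)
      = ∑ j, ∑ l, X l * (X j * X l - X l * X j) * X j := by
    simp only [hX, Finset.mul_sum, Finset.sum_mul, mul_smul_comm, smul_mul_assoc]
    rw [Finset.sum_comm_cycle]
    exact Finset.sum_congr rfl fun _ _ => Finset.sum_comm
  have h₂ : ∑ k, ∑ l, ∑ j, (c l j k : ℂ) • (X l * X k * X j)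
      = ∑ j, ∑ k, (X j * X k - X k * X j) * X k * X j := by
    simp only [hX, Finset.sum_mul, smul_mul_assoc]
    rw [Finset.sum_comm_cycle]
  simp only [symLieSum, Finset.mul_sum, mul_smul_comm, Complex.ofReal_add, add_smul, mul_add,
    Finset.sum_add_distrib, h₁, h₂]
  simp only [← Finset.sum_add_distrib]
  exact Finset.sum_congr rfl fun _ _ => Finset.sum_congr rfl fun _ _ => by noncomm_ring

theorem sum_symLieSum_commutator (c : Fin d → Fin d → Fin d → ℝ) (X : Fin d → B)
    (hX : ∀ i j, X i * X j - X j * X i = ∑ k : Fin d, (c k i j : ℂ) • X k) :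
    ∑ k, ∑ l, (symLieSum c X k l * (X k * X l) - X l * X k * symLieSum c X k l)
      = (2 : ℂ) • ((∑ k, X k ^ 2) * (∑ k, X k ^ 2) - ∑ k, ∑ l, X l * X k * (X k * X l)) := by
  have hswap : ∑ k, ∑ l, X l * X l * X k * X k = ∑ k, ∑ l, X k * X k * X l * X l :=
    Finset.sum_comm
  have hcomm : ∑ k, ∑ l, X l * X k * (X k * X l) = ∑ k, ∑ l, X k * X l * X l * X k := by
    rw [Finset.sum_comm]
    simp only [mul_assoc]
  have hsq : (∑ k, X k ^ 2) * (∑ k, X k ^ 2) = ∑ k, ∑ l, X k * X k * X l * X l := by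
    simp only [Finset.sum_mul_sum, pow_two, mul_assoc]
  simp only [Finset.sum_sub_distrib, sum_symLieSum_mul_mul c X hX, sum_mul_mul_symLieSum c X hX,
    hswap, hcomm, hsq]
  module

end LieSums

theorem isSelfAdjoint_of_mul_eq_one {R : Type*} [Monoid R] [StarMul R] {a b : R}
    (ha : IsSelfAdjoint a) (hab : a * b = 1) : IsSelfAdjoint b := by
  refine left_inv_eq_right_inv (a := a) ?_ hab
  rw [← ha.star_eq, ← star_mul, hab, star_one]

/-- In the setting of the paper the following identity holds:
`Y₀₀² + 2 Σ_{k=1}^d Y_{k0}* Y_{k0}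
  + Σ_{k,l=1}^d (Y_{kl} + (i/2) Σ_j b^k_{jl} Y_{j0})* (Y_{kl} + (i/2) Σ_j b^k_{jl} Y_{j0})
  = 1 + (1/4) Σ_{k,l=1}^d (Σ_j b^k_{jl} Y_{j0})* (Σ_j b^k_{jl} Y_{j0})`,
where `b^k_{jl} = c^k_{jl} + c^l_{jk}`. -/
theorem statement12 {B : Type*} [Ring B] [Algebra ℂ B] [StarRing B] [StarModule ℂ B]
    (d : ℕ) (hd : 1 ≤ d)
    (c : Fin d → Fin d → Fin d → ℝ)
    (hc : ∀ k i j, c k i j = - c k j i)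
    (X : Fin d → B)
    (hXstar : ∀ k, star (X k) = - X k)
    (hXlie : ∀ i j, X i * X j - X j * X i = ∑ k : Fin d, (c k i j : ℂ) • X k)
    (A Y : B) (hA : A = 1 - ∑ k : Fin d, X k ^ 2)
    (hAY : A * Y = 1) (hYA : Y * A = 1) :
    Ymat X Y 0 0 ^ 2
        + (2 : ℂ) • ∑ k : Fin d, star (Ymat X Y k.succ 0) * Ymat X Y k.succ 0
        + ∑ k : Fin d, ∑ l : Fin d,
            star (Ymat X Y k.succ l.succ
                + (Complex.I / 2) • ∑ j : Fin d,
                    ((c k j l + c l j k : ℝ) : ℂ) • Ymat X Y j.succ 0)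
              * (Ymat X Y k.succ l.succ
                + (Complex.I / 2) • ∑ j : Fin d,
                    ((c k j l + c l j k : ℝ) : ℂ) • Ymat X Y j.succ 0)
      = 1 + (4⁻¹ : ℂ) • ∑ k : Fin d, ∑ l : Fin d,
            star (∑ j : Fin d, ((c k j l + c l j k : ℝ) : ℂ) • Ymat X Y j.succ 0)
              * ∑ j : Fin d, ((c k j l + c l j k : ℝ) : ℂ) • Ymat X Y j.succ 0 := by
  have hA_star : star A = A := by
    simp [hA, star_sum, hXstar]
  have hY : star Y = Y := isSelfAdjoint_of_mul_eq_one hA_star hAY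
  have hY0 (k : Fin d) : Ymat X Y k.succ 0 = Complex.I • (X k * Y) := by
    simp [Ymat, extX]
  have hY00 : Ymat X Y 0 0 = -Y := by
    simp [Ymat, extX, smul_smul]
  have hYkl (k l : Fin d) : Ymat X Y k.succ l.succ = X k * X l * Y := rfl
  have hD (k l : Fin d) : ∑ j : Fin d, ((c k j l + c l j k : ℝ) : ℂ) • Ymat X Y j.succ 0
      = Complex.I • (symLieSum c X k l * Y) := by
    simp only [hY0, symLieSum, Finset.sum_mul, Finset.smul_sum, smul_mul_assoc,
      smul_comm Complex.I]
  have hDstar (k l : Fin d) : star (symLieSum c X k l) = -symLieSum c X k l := by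
    simp [symLieSum, star_sum, hXstar]
  have hnorm (Z : B) (hZ : star Z = -Z) :
      star (Complex.I • (Z * Y)) * (Complex.I • (Z * Y)) = -(Y * (Z * Z) * Y) := by
    simp [hZ, hY, smul_smul, mul_assoc]
  have hkl (k l : Fin d) :
      star (X k * X l * Y + (Complex.I / 2) • Complex.I • (symLieSum c X k l * Y))
          * (X k * X l * Y + (Complex.I / 2) • Complex.I • (symLieSum c X k l * Y))
        = Y * (X l * X k * (X k * X l)
            + (2⁻¹ : ℂ) • (symLieSum c X k l * (X k * X l) - X l * X k * symLieSum c X k l)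
            - (4⁻¹ : ℂ) • (symLieSum c X k l * symLieSum c X k l)) * Y := by
    have hI : Complex.I / 2 * Complex.I = -(2⁻¹ : ℂ) := by
      linear_combination (2⁻¹ : ℂ) * Complex.I_mul_I
    have h : X k * X l * Y + (Complex.I / 2) • Complex.I • (symLieSum c X k l * Y)
        = (X k * X l - (2⁻¹ : ℂ) • symLieSum c X k l) * Y := by
      rw [smul_smul, hI, sub_mul, smul_mul_assoc, neg_smul, sub_eq_add_neg]
    have h' : star (X k * X l - (2⁻¹ : ℂ) • symLieSum c X k l)
        = X l * X k + (2⁻¹ : ℂ) • symLieSum c X k l := by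
      simp [hXstar, hDstar]
    rw [h, star_mul, hY, h', ← mul_assoc, mul_assoc Y]
    congr 2
    simp only [add_mul, mul_sub, smul_mul_assoc, mul_smul_comm, smul_sub]
    module
  simp only [hD, hYkl, hkl, hnorm _ (hDstar _ _)]
  simp only [hY0, hnorm _ (hXstar _), hY00]
  simp only [← Finset.mul_sum, ← Finset.sum_mul, Finset.sum_neg_distrib, Finset.sum_sub_distrib,
    Finset.sum_add_distrib, ← Finset.smul_sum]
  simp only [← Finset.sum_sub_distrib]
  rw [sum_symLieSum_commutator c X hXlie]
  have hsq : ∑ k, X k * X k = 1 - A := by simp [hA, pow_two]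
  have hsq' : ∑ k, X k ^ 2 = 1 - A := by simp [hA]
  rw [hsq, hsq']
  have hone : Y * (A * A) * Y = 1 := by
    rw [← mul_assoc, hYA, one_mul, hAY]
  have hYAY : Y * A * Y = Y := by rw [hYA, one_mul]
  have hexp : (1 - A) * (1 - A) = 1 - (2 : ℂ) • A + A * A := by
    rw [two_smul]
    noncomm_ring
  rw [hexp]
  simp only [mul_add, add_mul, mul_sub, sub_mul, mul_smul_comm, smul_mul_assoc, smul_sub,
    smul_add, smul_smul, mul_one, hone, hYAY, pow_two, neg_mul_neg]
  module
end
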